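/- arXiv:2407.18797 — 3 statements merged into one kernel-verified Lean document; each statement's English description precedes it below -/
import Mathlib

section
/- For every integer d ≥ 4 there exist lattices (ℤ-lattices) L₁ and L₂ in d-dimensional Euclidean space ℝ^d such that: (i) for every r ≥ 0 the number of points of L₁ in the closed ball of radius r equals the number of points of L₂ in that ball; and (ii) there is no linear isometry (orthogonal transformation) of ℝ^d mapping L₁ onto L₂. -/
open MeasureTheory

namespace TetraLattice

variable {ι : Type*}

/-- The integer vectors whose coordinates at `e 0, …, e 3` reduce to the tetracode modulo `3`, have
a common parity, and satisfy a linear congruence modulo `4` that depends on the sign `s`. -/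
def tetra (e : Fin 4 → ι) (s : ℤ) : Submodule ℤ (ι → ℤ) where
  carrier := {x | 3 ∣ x (e 1) + x (e 2) + x (e 3) ∧ 3 ∣ x (e 0) + x (e 2) + 2 * x (e 3) ∧
    2 ∣ x (e 1) - x (e 0) ∧ 2 ∣ x (e 2) - x (e 0) ∧ 2 ∣ x (e 3) - x (e 0) ∧
    4 ∣ s * x (e 0) + x (e 1) + x (e 2) + x (e 3)}
  zero_mem' := by simp
  add_mem' := by
    rintro x y ⟨h1, h2, h3, h4, h5, h6⟩ ⟨k1, k2, k3, k4, k5, k6⟩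
    simp only [Set.mem_ofPred_eq, Pi.add_apply, mul_add]
    refine ⟨?_, ?_, ?_, ?_, ?_, ?_⟩ <;> omega
  smul_mem' := by
    rintro a x ⟨h1, h2, h3, h4, h5, h6⟩
    simp only [Set.mem_ofPred_eq, Pi.smul_apply, smul_eq_mul]
    refine ⟨(h1.mul_left a).trans (dvd_of_eq ?_), (h2.mul_left a).trans (dvd_of_eq ?_),
      (h3.mul_left a).trans (dvd_of_eq ?_), (h4.mul_left a).trans (dvd_of_eq ?_),
      (h5.mul_left a).trans (dvd_of_eq ?_), (h6.mul_left a).trans (dvd_of_eq ?_)⟩ <;> ring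

theorem mem_tetra {e : Fin 4 → ι} {s : ℤ} {x : ι → ℤ} :
    x ∈ tetra e s ↔ 3 ∣ x (e 1) + x (e 2) + x (e 3) ∧ 3 ∣ x (e 0) + x (e 2) + 2 * x (e 3) ∧
      2 ∣ x (e 1) - x (e 0) ∧ 2 ∣ x (e 2) - x (e 0) ∧ 2 ∣ x (e 3) - x (e 0) ∧
      4 ∣ s * x (e 0) + x (e 1) + x (e 2) + x (e 3) :=
  Iff.rfl

theorem twelve_smul_mem_tetra (e : Fin 4 → ι) (s : ℤ) (x : ι → ℤ) :
    (12 : ℤ) • x ∈ tetra e s := by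
  have h : s * (12 * x (e 0)) = 12 * (s * x (e 0)) := by ring
  simp only [mem_tetra, Pi.smul_apply, smul_eq_mul, h]
  refine ⟨?_, ?_, ?_, ?_, ?_, ?_⟩ <;> omega

/-- No map between the two lattices preserves all the products of like coordinates. -/
theorem not_exists_mul_eq_mul (e : Fin 4 ↪ ι) :
    ¬ ∃ g : tetra e 1 → tetra e (-1), ∀ x y : tetra e 1, ∀ i,
      (g x : ι → ℤ) i * (g y : ι → ℤ) i = (x : ι → ℤ) i * (y : ι → ℤ) i := by
  rintro ⟨g, hg⟩
  have key (a : Fin 4 → ℤ) (ha : a ∈ tetra id 1) :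
      ∃ x : tetra e 1, ∀ i, (x : ι → ℤ) (e i) = a i := by
    have h (i : Fin 4) : Function.extend e a 0 (e i) = a i := e.injective.extend_apply a 0 i
    exact ⟨⟨Function.extend e a 0, by simpa [mem_tetra, h] using ha⟩, h⟩
  obtain ⟨u, hu⟩ := key ![3, 3, 3, 3] (by simp [mem_tetra])
  obtain ⟨v, hv⟩ := key ![0, 4, 4, 4] (by simp [mem_tetra])
  obtain ⟨w, hw⟩ := key ![4, 0, 4, 8] (by simp [mem_tetra])
  have huu (i) := hg u u (e i)
  have huv (i) := hg u v (e i)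
  have huw (i) := hg u w (e i)
  simp only [hu, hv, hw] at huu huv huw
  have hu := mem_tetra.1 (g u).2
  have hv := mem_tetra.1 (g v).2
  have hw := mem_tetra.1 (g w).2
  have sgn (i : Fin 4) : (g u : ι → ℤ) (e i) = 3 ∨ (g u : ι → ℤ) (e i) = -3 := by
    rw [← sq_eq_sq_iff_eq_or_eq_neg, sq, huu]
    fin_cases i <;> rfl
  rcases sgn 0 with h0 | h0 <;> rcases sgn 1 with h1 | h1 <;> rcases sgn 2 with h2 | h2 <;>
    rcases sgn 3 with h3 | h3 <;>
    simp [Fin.forall_fin_succ, h0, h1, h2, h3] at hu huv huw <;> omega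

/-- The integer vector `x` with coordinates rescaled by `c`. -/
def scale (c : ι → ℝ) : (ι → ℤ) →ₗ[ℤ] EuclideanSpace ℝ ι where
  toFun x := WithLp.toLp 2 fun i => c i * x i
  map_add' x y := by ext i; simp [mul_add]
  map_smul' a x := by ext i; simp [mul_left_comm]

theorem scale_apply (c : ι → ℝ) (x : ι → ℤ) (i : ι) : scale c x i = c i * x i := rfl

theorem scale_injective {c : ι → ℝ} (hc : ∀ i, c i ≠ 0) : Function.Injective (scale c) := by
  intro x y h
  ext i
  simpa [scale_apply, hc i] using congrArg (fun v => v i) h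

theorem inner_scale [Fintype ι] (c : ι → ℝ) (x y : ι → ℤ) :
    inner ℝ (scale c x) (scale c y) = ∑ i, (x i * y i) • c i ^ 2 := by
  simp only [PiLp.inner_apply, scale_apply, zsmul_eq_mul]
  refine Finset.sum_congr rfl fun i _ => ?_
  simp
  ring

theorem not_exists_image_eq [Fintype ι] {c : ι → ℝ} (hc : LinearIndependent ℤ fun i => c i ^ 2)
    (e : Fin 4 ↪ ι) :
    ¬ ∃ f : EuclideanSpace ℝ ι ≃ₗᵢ[ℝ] EuclideanSpace ℝ ι,
      f '' ((tetra e 1).map (scale c) : Set (EuclideanSpace ℝ ι)) =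
        ((tetra e (-1)).map (scale c) : Set (EuclideanSpace ℝ ι)) := by
  rintro ⟨f, hf⟩
  have H (x : tetra e 1) : ∃ y : tetra e (-1), scale c y = f (scale c x) := by
    have h : f (scale c x) ∈ ((tetra e (-1)).map (scale c) : Set (EuclideanSpace ℝ ι)) :=
      hf ▸ ⟨_, ⟨x, x.2, rfl⟩, rfl⟩
    obtain ⟨y, hy, h⟩ := h
    exact ⟨⟨y, hy⟩, h⟩
  choose g hg using H
  refine not_exists_mul_eq_mul e ⟨g, fun x y => ?_⟩
  have h := f.inner_map_map (scale c x) (scale c y)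
  rw [← hg, ← hg, inner_scale, inner_scale] at h
  exact Fintype.linearIndependent_iffₛ.1 hc _ _ h

/-- The first of the four distinguished coordinates that vanishes modulo `3`; every word of the
tetracode has one. -/
def flipIndex (e : Fin 4 → ι) (x : ι → ℤ) : ι :=
  if 3 ∣ x (e 0) then e 0 else if 3 ∣ x (e 1) then e 1 else if 3 ∣ x (e 2) then e 2 else e 3

theorem three_dvd_apply_flipIndex {e : Fin 4 → ι} {s : ℤ} {x : ι → ℤ} (hx : x ∈ tetra e s) :
    3 ∣ x (flipIndex e x) := by
  obtain ⟨h1, h2, -⟩ := mem_tetra.1 hx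
  unfold flipIndex
  split_ifs <;> try assumption
  have h3 : x (e 2) % 3 = 1 ∨ x (e 2) % 3 = 2 := by omega
  have h4 : x (e 3) % 3 = 0 ∨ x (e 3) % 3 = 1 ∨ x (e 3) % 3 = 2 := by omega
  rcases h3 with h3 | h3 <;> rcases h4 with h4 | h4 | h4 <;> omega

variable [DecidableEq ι]

/-- Change the sign of the coordinate at `flipIndex`. -/
def flip (e : Fin 4 → ι) (x : ι → ℤ) : ι → ℤ :=
  Function.update x (flipIndex e x) (-x (flipIndex e x))

theorem flip_apply_eq_or_eq_neg (e : Fin 4 → ι) (x : ι → ℤ) (i : ι) :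
    flip e x i = x i ∨ flip e x i = -x i := by
  unfold flip
  rcases eq_or_ne i (flipIndex e x) with rfl | h
  · simp
  · simp [h]

theorem sq_flip_apply (e : Fin 4 → ι) (x : ι → ℤ) (i : ι) : flip e x i ^ 2 = x i ^ 2 :=
  sq_eq_sq_iff_eq_or_eq_neg.2 (flip_apply_eq_or_eq_neg e x i)

theorem flipIndex_flip (e : Fin 4 → ι) (x : ι → ℤ) : flipIndex e (flip e x) = flipIndex e x := by
  have h (i : ι) : 3 ∣ flip e x i ↔ 3 ∣ x i := by
    rcases flip_apply_eq_or_eq_neg e x i with h | h <;> simp [h]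
  simp only [flipIndex, h]

theorem flip_flip (e : Fin 4 → ι) (x : ι → ℤ) : flip e (flip e x) = x := by
  conv_lhs => rw [flip, flipIndex_flip]
  simp [flip]

theorem update_neg_mem_tetra (e : Fin 4 ↪ ι) {s : ℤ} (hs : s = 1 ∨ s = -1) {x : ι → ℤ}
    (hx : x ∈ tetra e s) (j : Fin 4) (hj : 3 ∣ x (e j)) :
    Function.update x (e j) (-x (e j)) ∈ tetra e (-s) := by
  rw [mem_tetra] at hx ⊢
  rcases hs with rfl | rfl <;> fin_cases j <;>
    simp [e.injective.eq_iff] at hj ⊢ <;> omega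

theorem flip_mem_tetra (e : Fin 4 ↪ ι) {s : ℤ} (hs : s = 1 ∨ s = -1) {x : ι → ℤ}
    (hx : x ∈ tetra e s) : flip e x ∈ tetra e (-s) := by
  obtain ⟨j, hj⟩ : ∃ j, flipIndex e x = e j := by
    unfold flipIndex
    split_ifs <;> exact ⟨_, rfl⟩
  have h := three_dvd_apply_flipIndex hx
  rw [flip, hj]
  exact update_neg_mem_tetra e hs hx j (hj ▸ h)

/-- `flip` exchanges the two lattices. -/
def flipEquiv (e : Fin 4 ↪ ι) : tetra e 1 ≃ tetra e (-1) where
  toFun x := ⟨flip e x, flip_mem_tetra e (.inl rfl) x.2⟩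
  invFun x := ⟨flip e x, by simpa using flip_mem_tetra e (.inr rfl) x.2⟩
  left_inv x := Subtype.ext (flip_flip e x)
  right_inv x := Subtype.ext (flip_flip e x)

variable [Fintype ι]

theorem norm_scale_flip (c : ι → ℝ) (e : Fin 4 → ι) (x : ι → ℤ) :
    ‖scale c (flip e x)‖ = ‖scale c x‖ := by
  simp only [EuclideanSpace.norm_eq, scale_apply, Real.norm_eq_abs, sq_abs, mul_pow]
  simp only [← Int.cast_pow, sq_flip_apply]

/-- The orthogonal basis of vectors `c i • e i`. -/
noncomputable def scaleBasis {c : ι → ℝ} (hc : ∀ i, c i ≠ 0) :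
    Module.Basis ι ℝ (EuclideanSpace ℝ ι) :=
  (EuclideanSpace.basisFun ι ℝ).toBasis.isUnitSMul fun i => (hc i).isUnit

theorem scaleBasis_apply {c : ι → ℝ} (hc : ∀ i, c i ≠ 0) (i : ι) :
    scaleBasis hc i = scale c (Pi.single i 1) := by
  ext j
  rcases eq_or_ne j i with rfl | h <;>
    simp [scaleBasis, Module.Basis.isUnitSMul_apply, scale_apply, *]

theorem scale_eq_sum {c : ι → ℝ} (hc : ∀ i, c i ≠ 0) (x : ι → ℤ) :
    scale c x = ∑ i, x i • scaleBasis hc i := by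
  simp_rw [scaleBasis_apply, ← map_smul, ← map_sum]
  congr 1
  ext j
  simp [Pi.single_apply]

theorem discreteTopology_map_scale {c : ι → ℝ} (hc : ∀ i, c i ≠ 0) (M : Submodule ℤ (ι → ℤ)) :
    DiscreteTopology (M.map (scale c)) := by
  have h : DiscreteTopology (Submodule.span ℤ (Set.range (scaleBasis hc))) := inferInstance
  refine DiscreteTopology.of_subset h ?_
  rintro _ ⟨x, -, rfl⟩
  rw [SetLike.mem_coe, scale_eq_sum hc]
  exact sum_mem fun i _ => Submodule.smul_mem _ _ (Submodule.subset_span ⟨i, rfl⟩)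

theorem span_map_scale_tetra {c : ι → ℝ} (hc : ∀ i, c i ≠ 0) (e : Fin 4 → ι) (s : ℤ) :
    Submodule.span ℝ ((tetra e s).map (scale c) : Set (EuclideanSpace ℝ ι)) = ⊤ := by
  rw [eq_top_iff, ← (scaleBasis hc).span_eq, Submodule.span_le]
  rintro _ ⟨i, rfl⟩
  have h := Submodule.smul_mem _ (12⁻¹ : ℝ) (Submodule.subset_span (R := ℝ)
    (Submodule.mem_map_of_mem (f := scale c) (twelve_smul_mem_tetra e s (Pi.single i 1))))
  convert! h using 1
  rw [scaleBasis_apply, map_smul, ← Int.cast_smul_eq_zsmul ℝ, smul_smul]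
  norm_num

theorem card_norm_le_eq {c : ι → ℝ} (hc : ∀ i, c i ≠ 0) (e : Fin 4 ↪ ι) (r : ℝ) :
    Nat.card {v : (tetra e 1).map (scale c) // ‖(v : EuclideanSpace ℝ ι)‖ ≤ r} =
      Nat.card {v : (tetra e (-1)).map (scale c) // ‖(v : EuclideanSpace ℝ ι)‖ ≤ r} := by
  let E (s : ℤ) := Submodule.equivMapOfInjective (scale c) (scale_injective hc) (tetra e s)
  refine Nat.card_congr (((E 1).symm.toEquiv.trans
    ((flipEquiv e).trans (E (-1)).toEquiv)).subtypeEquiv fun v => ?_)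
  obtain ⟨x, rfl⟩ := (E 1).surjective v
  simp [E, flipEquiv, norm_scale_flip]

end TetraLattice

theorem Transcendental.linearIndependent_pow_nat {R A : Type*} [CommRing R] [CommRing A]
    [Algebra R A] {t : A} (ht : Transcendental R t) : LinearIndependent R fun n : ℕ => t ^ n := by
  have h := (Polynomial.basisMonomials R).linearIndependent.map'
    (Polynomial.aeval t).toLinearMap
    (LinearMap.ker_eq_bot.2 (transcendental_iff_injective.1 ht))
  convert! h using 1
  ext n
  simp

/-- For every `d ≥ 4` there exist two `ℤ`-lattices in `ℝ^d` (discrete subgroups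
spanning `ℝ^d` over `ℝ`) with identical counting functions for points in closed
balls centered at the origin, such that no linear isometry of `ℝ^d` maps one
onto the other. -/
theorem exists_isospectral_nonisometric_lattices (d : ℕ) (hd : 4 ≤ d) :
    ∃ L₁ L₂ : Submodule ℤ (EuclideanSpace ℝ (Fin d)),
      DiscreteTopology L₁ ∧ DiscreteTopology L₂ ∧
      Submodule.span ℝ (L₁ : Set (EuclideanSpace ℝ (Fin d))) = ⊤ ∧
      Submodule.span ℝ (L₂ : Set (EuclideanSpace ℝ (Fin d))) = ⊤ ∧
      (∀ r : ℝ, 0 ≤ r →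
        Nat.card {v : L₁ // ‖(v : EuclideanSpace ℝ (Fin d))‖ ≤ r} =
          Nat.card {v : L₂ // ‖(v : EuclideanSpace ℝ (Fin d))‖ ≤ r}) ∧
      ¬ ∃ f : EuclideanSpace ℝ (Fin d) ≃ₗᵢ[ℝ] EuclideanSpace ℝ (Fin d),
          f '' (L₁ : Set (EuclideanSpace ℝ (Fin d))) =
            (L₂ : Set (EuclideanSpace ℝ (Fin d))) := by
  have ht := (transcendental_liouvilleNumber le_rfl).pow two_pos
  set t := liouvilleNumber (2 : ℕ)
  have ht0 : t ≠ 0 := by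
    intro h
    rw [h] at ht
    exact ht (by simpa using isAlgebraic_zero)
  let c (i : Fin d) : ℝ := t ^ (i : ℕ)
  have hc (i : Fin d) : c i ≠ 0 := pow_ne_zero _ ht0
  have hli : LinearIndependent ℤ fun i => c i ^ 2 := by
    simpa only [c, Function.comp_def, pow_right_comm] using
      ht.linearIndependent_pow_nat.comp _ Fin.val_injective
  let e : Fin 4 ↪ Fin d := Fin.castLEEmb hd
  exact ⟨(TetraLattice.tetra e 1).map (TetraLattice.scale c),
    (TetraLattice.tetra e (-1)).map (TetraLattice.scale c),
    TetraLattice.discreteTopology_map_scale hc _, TetraLattice.discreteTopology_map_scale hc _,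
    TetraLattice.span_map_scale_tetra hc _ _, TetraLattice.span_map_scale_tetra hc _ _,
    fun r _ => TetraLattice.card_norm_le_eq hc e r, TetraLattice.not_exists_image_eq hli e⟩
end

section
/- Let n ≥ 1, let U ⊆ ℝⁿ be a nonempty open connected set, let λ ∈ ℝ, and let f, g : ℝⁿ → ℝ be smooth on U with Δf = −λ² f and Δg = −λ² g on U. If f(x)² = g(x)² for every x ∈ U, then either f = g on all of U or f = −g on all of U. -/
open scoped BigOperators

/-- The Euclidean Laplacian on `ℝⁿ`: `Δf = ∑ i, ∂²f/∂xᵢ²`. -/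
noncomputable def euclideanLaplacian {n : ℕ} (f : EuclideanSpace ℝ (Fin n) → ℝ)
    (x : EuclideanSpace ℝ (Fin n)) : ℝ :=
  ∑ i : Fin n,
    iteratedFDeriv ℝ 2 f x ![EuclideanSpace.single i 1, EuclideanSpace.single i 1]

open MeasureTheory Filter Topology
open scoped ContDiff

section DirectionalDerivative

variable {E : Type*} [NormedAddCommGroup E] [NormedSpace ℝ E]

/-- The derivative of `f` in the direction `e`. -/
noncomputable def dirDeriv (e : E) (f : E → ℝ) (x : E) : ℝ := fderiv ℝ f x e

theorem ContDiff.dirDeriv {f : E → ℝ} (hf : ContDiff ℝ ∞ f) (e : E) :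
    ContDiff ℝ ∞ (dirDeriv e f) :=
  (hf.fderiv_right (m := ∞) (by simp)).clm_apply contDiff_const

theorem HasCompactSupport.dirDeriv {f : E → ℝ} (hf : HasCompactSupport f) (e : E) :
    HasCompactSupport (dirDeriv e f) :=
  hf.fderiv_apply ℝ e

theorem ContDiff.iterate_dirDeriv {f : E → ℝ} (hf : ContDiff ℝ ∞ f) (e : E) (k : ℕ) :
    ContDiff ℝ ∞ ((_root_.dirDeriv e)^[k] f) := by
  induction k with
  | zero => exact hf
  | succ k ih => rw [Function.iterate_succ_apply']; exact ih.dirDeriv e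

theorem HasCompactSupport.iterate_dirDeriv {f : E → ℝ} (hf : HasCompactSupport f) (e : E)
    (k : ℕ) : HasCompactSupport ((_root_.dirDeriv e)^[k] f) := by
  induction k with
  | zero => exact hf
  | succ k ih => rw [Function.iterate_succ_apply']; exact ih.dirDeriv e

theorem dirDeriv_mul {f g : E → ℝ} {x : E} (hf : DifferentiableAt ℝ f x)
    (hg : DifferentiableAt ℝ g x) (e : E) :
    dirDeriv e (fun y => f y * g y) x = f x * dirDeriv e g x + dirDeriv e f x * g x := by
  simp only [dirDeriv, fderiv_fun_mul hf hg, _root_.add_apply,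
    _root_.smul_apply, smul_eq_mul]
  ring

theorem Filter.EventuallyEq.dirDeriv {f g : E → ℝ} {x : E} (h : f =ᶠ[𝓝 x] g) (e : E) :
    _root_.dirDeriv e f =ᶠ[𝓝 x] _root_.dirDeriv e g :=
  h.fderiv.mono fun y hy => by
    change fderiv ℝ f y e = fderiv ℝ g y e
    rw [hy]

theorem dirDeriv_zero (e : E) : dirDeriv e (0 : E → ℝ) = 0 := by
  funext x; simp [dirDeriv]

theorem eventuallyEq_zero_iterate_dirDeriv {f : E → ℝ} {x : E} (h : f =ᶠ[𝓝 x] 0) (e : E)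
    (k : ℕ) : (dirDeriv e)^[k] f =ᶠ[𝓝 x] 0 := by
  induction k with
  | zero => exact h
  | succ k ih =>
    rw [Function.iterate_succ_apply']
    exact (ih.dirDeriv e).trans (by rw [dirDeriv_zero])

theorem dirDeriv_dirDeriv_apply {f : E → ℝ} (hf : ContDiff ℝ ∞ f) (a b : E) (x : E) :
    dirDeriv a (dirDeriv b f) x = fderiv ℝ (fderiv ℝ f) x a b := by
  have hd : DifferentiableAt ℝ (fderiv ℝ f) x :=
    ((hf.fderiv_right (m := ∞) (by simp)).differentiable (by simp)).differentiableAt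
  change fderiv ℝ (fun y => fderiv ℝ f y b) x a = _
  rw [fderiv_clm_apply hd (differentiableAt_const b)]
  simp

theorem dirDeriv_comm {f : E → ℝ} (hf : ContDiff ℝ ∞ f) (a b : E) :
    dirDeriv a (dirDeriv b f) = dirDeriv b (dirDeriv a f) := by
  funext x
  rw [dirDeriv_dirDeriv_apply hf, dirDeriv_dirDeriv_apply hf]
  exact (hf.contDiffAt.isSymmSndFDerivAt (by
    rw [minSmoothness_of_isRCLikeNormedField]; norm_cast)) a b

theorem dirDeriv_sum {ι : Type*} (s : Finset ι) {f : ι → E → ℝ} {x : E}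
    (hf : ∀ i ∈ s, DifferentiableAt ℝ (f i) x) (e : E) :
    dirDeriv e (fun y => ∑ i ∈ s, f i y) x = ∑ i ∈ s, dirDeriv e (f i) x := by
  simp [dirDeriv, fderiv_fun_sum hf]

theorem hasDerivAt_comp_add_smul {f : E → ℝ} (hf : ContDiff ℝ ∞ f) (y e : E) (t : ℝ) :
    HasDerivAt (fun s : ℝ => f (y + s • e)) (dirDeriv e f (y + t • e)) t := by
  have h1 : HasDerivAt (fun s : ℝ => y + s • e) e t := by
    simpa using ((hasDerivAt_id t).smul_const e).const_add y
  exact ((hf.differentiable (by simp)) (y + t • e)).hasFDerivAt.comp_hasDerivAt t h1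

variable [MeasurableSpace E] [BorelSpace E] (μ : Measure E) [μ.IsAddHaarMeasure]

theorem integral_dirDeriv_eq_zero [FiniteDimensional ℝ E] {f : E → ℝ} (hf : ContDiff ℝ ∞ f)
    (hs : HasCompactSupport f) (e : E) : ∫ x, dirDeriv e f x ∂μ = 0 := by
  have h1 : Integrable f μ := hf.continuous.integrable_of_hasCompactSupport hs
  have h2 : Integrable (dirDeriv e f) μ :=
    (hf.dirDeriv e).continuous.integrable_of_hasCompactSupport (hs.dirDeriv e)
  have := integral_mul_fderiv_eq_neg_fderiv_mul_of_integrable (μ := μ) (f := fun _ => (1 : ℝ))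
    (g := f) (v := e) (by simp) (by simp only [one_mul]; exact h2) (by simpa using h1)
    (fun x _ => differentiableAt_const _) (fun x _ => (hf.differentiable (by simp)) x)
  simpa [dirDeriv] using this

theorem hasDerivAt_integral_mul_comp_add_smul {φ w : E → ℝ} (hφ : Continuous φ)
    (hφs : HasCompactSupport φ) (hw : ContDiff ℝ ∞ w) (hws : HasCompactSupport w)
    (e : E) (t : ℝ) :
    HasDerivAt (fun s : ℝ => ∫ y, φ y * w (y + s • e) ∂μ)
      (∫ y, φ y * dirDeriv e w (y + t • e) ∂μ) t := by
  obtain ⟨C, hC⟩ := (hws.dirDeriv e).exists_bound_of_continuous (hw.dirDeriv e).continuous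
  have hc : ∀ s : ℝ, Continuous fun y => φ y * w (y + s • e) := fun s =>
    hφ.mul (hw.continuous.comp (by fun_prop))
  refine (hasDerivAt_integral_of_dominated_loc_of_deriv_le (bound := fun y => ‖φ y‖ * C)
    (s := Set.univ) univ_mem (Eventually.of_forall fun s => (hc s).aestronglyMeasurable)
    ((hc t).integrable_of_hasCompactSupport hφs.mul_right)
    (hφ.mul ((hw.dirDeriv e).continuous.comp (by fun_prop))).aestronglyMeasurable
    (Eventually.of_forall fun y s _ => ?_)
    ((hφ.integrable_of_hasCompactSupport hφs).norm.mul_const C)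
    (Eventually.of_forall fun y s _ => (hasDerivAt_comp_add_smul hw y e s).const_mul _)).2
  rw [norm_mul]
  exact mul_le_mul_of_nonneg_left (hC _) (norm_nonneg _)

end DirectionalDerivative

/-- A sequence of successive derivatives with factorial growth of ratio less than one,
all of which vanish at `0`, vanishes at `1`. -/
theorem eq_zero_of_hasDerivAt_succ_of_le_factorial {J : ℕ → ℝ → ℝ} {M θ : ℝ}
    (hJ : ∀ k t, HasDerivAt (J k) (J (k + 1) t) t) (h0 : ∀ k, J k 0 = 0)
    (hθ0 : 0 ≤ θ) (hθ1 : θ < 1)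
    (hb : ∀ k, ∀ t ∈ Set.Icc (0 : ℝ) 1, |J k t| ≤ M * (θ ^ k * k.factorial)) :
    J 0 1 = 0 := by
  have key : ∀ j k, ∀ t ∈ Set.Icc (0 : ℝ) 1,
      |J k t| ≤ M * (θ ^ (k + j) * (k + j).factorial) * (t ^ j / j.factorial) := by
    intro j
    induction j with
    | zero => intro k t ht; simpa using hb k t ht
    | succ j ih =>
      intro k t ht
      set A := M * (θ ^ (k + (j + 1)) * (k + (j + 1)).factorial) with hA
      have hderiv : ∀ x : ℝ, HasDerivAt (fun s : ℝ => A * (s ^ (j + 1) / (j + 1).factorial))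
          (A * (x ^ j / j.factorial)) x := by
        intro x
        have := (((hasDerivAt_pow (j + 1) x).div_const ((j + 1).factorial : ℝ)).const_mul A)
        refine this.congr_deriv ?_
        rw [Nat.factorial_succ]
        have : (j.factorial : ℝ) ≠ 0 := by positivity
        push_cast
        field_simp
      refine image_norm_le_of_norm_deriv_right_le_deriv_boundary (f := J k) (f' := J (k + 1))
        (a := 0) (b := 1) (fun x _ => (hJ k x).continuousAt.continuousWithinAt)
        (fun x _ => (hJ k x).hasDerivWithinAt) ?_ hderiv ?_ ht
      · simp [h0]
      · intro x hx
        have := ih (k + 1) x ⟨hx.1, hx.2.le⟩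
        rw [show k + 1 + j = k + (j + 1) by ring] at this
        exact this
  have hle : ∀ j : ℕ, |J 0 1| ≤ M * θ ^ j := by
    intro j
    have := key j 0 1 (by simp)
    have hj : (j.factorial : ℝ) ≠ 0 := by positivity
    simp only [zero_add, one_pow] at this
    calc |J 0 1| ≤ _ := this
      _ = M * θ ^ j := by field_simp
  have hlim : Tendsto (fun j : ℕ => M * θ ^ j) atTop (𝓝 0) := by
    simpa using (tendsto_pow_atTop_nhds_zero_of_lt_one hθ0 hθ1).const_mul M
  exact abs_nonpos_iff.1 (ge_of_tendsto' hlim hle)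

section Laplacian

variable {n : ℕ}

local notation "𝔼" => EuclideanSpace ℝ (Fin n)

/-- The partial derivative in the `i`-th coordinate. -/
noncomputable abbrev partialDeriv (i : Fin n) (f : EuclideanSpace ℝ (Fin n) → ℝ) :
    EuclideanSpace ℝ (Fin n) → ℝ :=
  dirDeriv (EuclideanSpace.single i 1) f

theorem euclideanLaplacian_eq_sum_partialDeriv {f : 𝔼 → ℝ} (hf : ContDiff ℝ ∞ f) (x : 𝔼) :
    euclideanLaplacian f x = ∑ i, partialDeriv i (partialDeriv i f) x := by
  simp [euclideanLaplacian, iteratedFDeriv_two_apply, partialDeriv, dirDeriv_dirDeriv_apply hf]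

theorem Filter.EventuallyEq.euclideanLaplacian_eq {f g : 𝔼 → ℝ} {x : 𝔼} (h : f =ᶠ[𝓝 x] g) :
    euclideanLaplacian f x = euclideanLaplacian g x := by
  simp only [euclideanLaplacian, (h.iteratedFDeriv ℝ 2).eq_of_nhds]

theorem euclideanLaplacian_sub {f g : 𝔼 → ℝ} {x : 𝔼} (hf : ContDiffAt ℝ 2 f x)
    (hg : ContDiffAt ℝ 2 g x) :
    euclideanLaplacian (f - g) x = euclideanLaplacian f x - euclideanLaplacian g x := by
  simp [euclideanLaplacian, iteratedFDeriv_sub_apply (i := 2) hf hg, Finset.sum_sub_distrib]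

theorem euclideanLaplacian_dirDeriv {v : 𝔼 → ℝ} (hv : ContDiff ℝ ∞ v) {κ : ℝ} {x : 𝔼}
    (h : ∀ᶠ y in 𝓝 x, euclideanLaplacian v y = -κ * v y) (e : 𝔼) :
    euclideanLaplacian (dirDeriv e v) x = -κ * dirDeriv e v x := by
  have h1 : (fun y => ∑ i, partialDeriv i (partialDeriv i v) y) =ᶠ[𝓝 x] fun y => -κ * v y :=
    h.mono fun y hy =>
      (euclideanLaplacian_eq_sum_partialDeriv hv y).symm.trans hy
  have hd : ∀ i : Fin n, ContDiff ℝ ∞ (partialDeriv i (partialDeriv i v)) :=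
    fun i => (hv.dirDeriv _).dirDeriv _
  have h2 := (h1.dirDeriv e).eq_of_nhds
  rw [dirDeriv_sum _ (fun i _ => (hd i).differentiable (by simp) x),
    dirDeriv_mul (differentiableAt_const _) (hv.differentiable (by simp) x)] at h2
  rw [euclideanLaplacian_eq_sum_partialDeriv (hv.dirDeriv e)]
  calc _ = ∑ i, dirDeriv e (partialDeriv i (partialDeriv i v)) x := by
        refine Finset.sum_congr rfl fun i _ => ?_
        rw [partialDeriv, partialDeriv, dirDeriv_comm hv, dirDeriv_comm (hv.dirDeriv _)]
    _ = _ := by rw [h2]; simp [dirDeriv]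

theorem dirDeriv_sq_le {v : 𝔼 → ℝ} (e x : 𝔼) :
    dirDeriv e v x ^ 2 ≤ ‖e‖ ^ 2 * ∑ i, partialDeriv i v x ^ 2 := by
  have h : dirDeriv e v x = ∑ i, e i * partialDeriv i v x := by
    have he : e = ∑ i, e i • EuclideanSpace.single i (1 : ℝ) := by
      simpa using ((EuclideanSpace.basisFun (Fin n) ℝ).sum_repr e).symm
    conv_lhs => rw [dirDeriv, he, map_sum]
    simp [partialDeriv, dirDeriv]
  rw [h, EuclideanSpace.norm_sq_eq]
  simpa using Finset.sum_mul_sq_le_sq_mul_sq Finset.univ (fun i => e i)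
    (fun i => partialDeriv i v x)

/-- Caccioppoli's inequality with a cutoff function `ζ`. -/
theorem caccioppoli_inequality {ζ v : 𝔼 → ℝ} (hζ : ContDiff ℝ ∞ ζ) (hv : ContDiff ℝ ∞ v)
    (hvs : HasCompactSupport v) {κ : ℝ}
    (h : ∀ x, ζ x ≠ 0 → euclideanLaplacian v x = -κ * v x) :
    ∫ x, ζ x ^ 2 * ∑ i, partialDeriv i v x ^ 2 ≤
      ∫ x, (2 * κ * ζ x ^ 2 + 4 * ∑ i, partialDeriv i ζ x ^ 2) * v x ^ 2 := by
  let F : Fin n → 𝔼 → ℝ := fun i x => (ζ x * ζ x) * (v x * partialDeriv i v x)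
  have hF : ∀ i, ContDiff ℝ ∞ (F i) := fun i =>
    (hζ.mul hζ).mul (hv.mul (hv.dirDeriv _))
  have hFs : ∀ i, HasCompactSupport (F i) := fun i => (hvs.mul_right).mul_left
  have hFi : ∀ i, Integrable (partialDeriv i (F i)) := fun i =>
    ((hF i).dirDeriv _).continuous.integrable_of_hasCompactSupport ((hFs i).dirDeriv _)
  have hdiv : ∫ x, ∑ i, partialDeriv i (F i) x = 0 := by
    rw [integral_finsetSum _ fun i _ => hFi i]
    exact Finset.sum_eq_zero fun i _ => integral_dirDeriv_eq_zero volume (hF i) (hFs i) _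
  have hζd : ∀ x, DifferentiableAt ℝ ζ x := hζ.differentiable (by simp)
  have hvd : ∀ x, DifferentiableAt ℝ v x := hv.differentiable (by simp)
  have hFx : ∀ i x, partialDeriv i (F i) x =
      ζ x ^ 2 * partialDeriv i v x ^ 2 + ζ x ^ 2 * v x * partialDeriv i (partialDeriv i v) x
        + 2 * ζ x * v x * partialDeriv i ζ x * partialDeriv i v x := by
    intro i x
    have hpd : DifferentiableAt ℝ (partialDeriv i v) x :=
      (hv.dirDeriv _).differentiable (by simp) x
    simp only [F, partialDeriv] at hpd ⊢
    rw [dirDeriv_mul ((hζd x).fun_mul (hζd x)) ((hvd x).fun_mul hpd),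
      dirDeriv_mul (hζd x) (hζd x), dirDeriv_mul (hvd x) hpd]
    ring
  have hpt : ∀ x, ζ x ^ 2 * ∑ i, partialDeriv i v x ^ 2 ≤ 2 * ∑ i, partialDeriv i (F i) x +
      (2 * κ * ζ x ^ 2 + 4 * ∑ i, partialDeriv i ζ x ^ 2) * v x ^ 2 := by
    intro x
    have hlap : ζ x ^ 2 * v x * ∑ i, partialDeriv i (partialDeriv i v) x =
        -κ * ζ x ^ 2 * v x ^ 2 := by
      rw [← euclideanLaplacian_eq_sum_partialDeriv hv]
      by_cases hx : ζ x = 0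
      · simp [hx]
      · rw [h x hx]; ring
    have hcross : ∀ i, -(2 * (2 * ζ x * v x * partialDeriv i ζ x * partialDeriv i v x)) ≤
        ζ x ^ 2 * partialDeriv i v x ^ 2 + 4 * partialDeriv i ζ x ^ 2 * v x ^ 2 := fun i => by
      nlinarith [sq_nonneg (ζ x * partialDeriv i v x + 2 * partialDeriv i ζ x * v x)]
    have hsum := Finset.sum_le_sum fun i (_ : i ∈ Finset.univ) => hcross i
    simp only [hFx, Finset.sum_add_distrib, ← Finset.mul_sum, ← Finset.sum_mul,
      Finset.sum_neg_distrib, hlap] at hsum ⊢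
    linarith
  have hc : ∀ i, Continuous (partialDeriv i v) := fun i => (hv.dirDeriv _).continuous
  have hcζ : ∀ i, Continuous (partialDeriv i ζ) := fun i => (hζ.dirDeriv _).continuous
  have hζc := hζ.continuous
  have hvc := hv.continuous
  have hi1 : Integrable fun x => ζ x ^ 2 * ∑ i, partialDeriv i v x ^ 2 := by
    simp only [Finset.mul_sum]
    refine integrable_finsetSum _ fun i _ => ?_
    refine Continuous.integrable_of_hasCompactSupport (by fun_prop) ?_
    simp only [sq (partialDeriv i v _)]
    exact ((hvs.dirDeriv _).mul_left).mul_left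
  have hi2 : Integrable fun x => 2 * ∑ i, partialDeriv i (F i) x :=
    (integrable_finsetSum _ fun i _ => hFi i).const_mul 2
  have hi3 : Integrable fun x =>
      (2 * κ * ζ x ^ 2 + 4 * ∑ i, partialDeriv i ζ x ^ 2) * v x ^ 2 := by
    refine Continuous.integrable_of_hasCompactSupport (by fun_prop) ?_
    simp only [sq (v _)]
    exact (hvs.mul_left).mul_left
  calc _ ≤ ∫ x, (2 * ∑ i, partialDeriv i (F i) x +
        (2 * κ * ζ x ^ 2 + 4 * ∑ i, partialDeriv i ζ x ^ 2) * v x ^ 2) :=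
        integral_mono hi1 (hi2.add hi3) hpt
    _ = _ := by rw [integral_add hi2 hi3, integral_const_mul, hdiv]; simp

theorem euclideanLaplacian_iterate_dirDeriv {η w : 𝔼 → ℝ} (hη : Continuous η)
    (hw : ContDiff ℝ ∞ w) {κ : ℝ}
    (h : ∀ x, η x ≠ 0 → euclideanLaplacian w x = -κ * w x) (e : 𝔼) (k : ℕ) :
    ∀ x, η x ≠ 0 →
      euclideanLaplacian ((dirDeriv e)^[k] w) x = -κ * (dirDeriv e)^[k] w x := by
  induction k with
  | zero => exact h
  | succ k ih =>
    intro x hx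
    rw [Function.iterate_succ_apply']
    exact euclideanLaplacian_dirDeriv (hw.iterate_dirDeriv e k)
      ((hη.continuousAt.eventually_ne hx).mono ih) e

theorem partialDeriv_pow_succ {η : 𝔼 → ℝ} (hη : ContDiff ℝ ∞ η) (i : Fin n) (k : ℕ) (x : 𝔼) :
    partialDeriv i (fun y => η y ^ (k + 1)) x = (k + 1) * η x ^ k * partialDeriv i η x := by
  simp only [partialDeriv, dirDeriv]
  rw [fderiv_fun_pow _ (hη.differentiable (by simp) x)]
  simp

/-- Iterated Caccioppoli inequality: the derivatives of an eigenfunction in a sufficiently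
short direction have geometrically small factorial growth in weighted `L²`. -/
theorem integral_iterate_dirDeriv_sq_le {η w : 𝔼 → ℝ} (hη : ContDiff ℝ ∞ η)
    (hη1 : ∀ x, |η x| ≤ 1) {K : ℝ} (hK : ∀ x, ∑ i, partialDeriv i η x ^ 2 ≤ K)
    (hw : ContDiff ℝ ∞ w) (hws : HasCompactSupport w) {κ : ℝ} (hκ : 0 ≤ κ)
    (h : ∀ x, η x ≠ 0 → euclideanLaplacian w x = -κ * w x) {e : 𝔼}
    (he : ‖e‖ ^ 2 * (2 * κ + 4 * K) ≤ (1 / 2) ^ 2) (k : ℕ) :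
    ∫ x, (η x ^ k) ^ 2 * (dirDeriv e)^[k] w x ^ 2 ≤
      ((1 / 2) ^ k * k.factorial) ^ 2 * ∫ x, w x ^ 2 := by
  have hηc := hη.continuous
  have hint : ∀ (ζ v : 𝔼 → ℝ), Continuous ζ → Continuous v → HasCompactSupport v →
      Integrable fun x => ζ x * v x ^ 2 := by
    intro ζ v hζ hv hvs
    refine Continuous.integrable_of_hasCompactSupport (by fun_prop) ?_
    simp only [sq (v _)]
    exact (hvs.mul_left).mul_left
  induction k with
  | zero => simp
  | succ k ih =>
    set v := (dirDeriv e)^[k] w with hv_def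
    have hv : ContDiff ℝ ∞ v := hw.iterate_dirDeriv e k
    have hvs : HasCompactSupport v := hws.iterate_dirDeriv e k
    have hcac := caccioppoli_inequality (ζ := fun x => η x ^ (k + 1)) (hη.pow _) hv hvs
      (fun x hx => euclideanLaplacian_iterate_dirDeriv hηc hw h e k x
        (fun h0 => hx (by simp [h0])))
    have hcv : ∀ i, Continuous (partialDeriv i v) := fun i => (hv.dirDeriv _).continuous
    have hcζ : ∀ i, Continuous (partialDeriv i η) := fun i => (hη.dirDeriv _).continuous
    have hvc := hv.continuous
    rw [Function.iterate_succ_apply', ← hv_def]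
    calc ∫ x, (η x ^ (k + 1)) ^ 2 * dirDeriv e v x ^ 2
        ≤ ∫ x, ‖e‖ ^ 2 * ((η x ^ (k + 1)) ^ 2 * ∑ i, partialDeriv i v x ^ 2) := by
          refine integral_mono (hint _ _ (by fun_prop) (hv.dirDeriv e).continuous
            (hvs.dirDeriv e)) ?_ fun x => ?_
          · refine Integrable.const_mul ?_ _
            simp only [Finset.mul_sum]
            exact integrable_finsetSum _ fun i _ =>
              hint _ _ (by fun_prop) (hcv i) (hvs.dirDeriv _)
          · have := mul_le_mul_of_nonneg_left (dirDeriv_sq_le (v := v) e x)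
              (sq_nonneg (η x ^ (k + 1)))
            simp only
            linarith
      _ = ‖e‖ ^ 2 * ∫ x, (η x ^ (k + 1)) ^ 2 * ∑ i, partialDeriv i v x ^ 2 :=
          integral_const_mul _ _
      _ ≤ ‖e‖ ^ 2 * ∫ x, ((2 * κ + 4 * K) * (k + 1) ^ 2) * ((η x ^ k) ^ 2 * v x ^ 2) := by
          refine mul_le_mul_of_nonneg_left (hcac.trans ?_) (sq_nonneg _)
          refine integral_mono (hint _ _ ?_ hvc hvs)
            ((hint _ _ (by fun_prop) hvc hvs).const_mul _) fun x => ?_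
          · simp only [partialDeriv_pow_succ hη]
            fun_prop
          · simp only [partialDeriv_pow_succ hη, mul_pow, ← Finset.mul_sum]
            have hη2 : η x ^ 2 ≤ 1 := (sq_le_one_iff_abs_le_one _).2 (hη1 x)
            have hk : (1 : ℝ) ≤ (k + 1) ^ 2 := by
              have : (0 : ℝ) ≤ k := k.cast_nonneg
              nlinarith
            have h1 : κ * η x ^ 2 ≤ κ * (k + 1) ^ 2 :=
              mul_le_mul_of_nonneg_left (hη2.trans hk) hκ
            have h2 := mul_le_mul_of_nonneg_left (hK x) (sq_nonneg ((k : ℝ) + 1))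
            have h3 : 0 ≤ (η x ^ k) ^ 2 * v x ^ 2 := by positivity
            have h4 := mul_le_mul_of_nonneg_right
              (show 2 * (κ * η x ^ 2) + 4 * (((k : ℝ) + 1) ^ 2 * ∑ i, partialDeriv i η x ^ 2)
                ≤ (2 * κ + 4 * K) * (k + 1) ^ 2 by linarith) h3
            calc _ = _ := by ring
              _ ≤ _ := h4
      _ = ‖e‖ ^ 2 * (2 * κ + 4 * K) * ((k + 1) ^ 2 * ∫ x, (η x ^ k) ^ 2 * v x ^ 2) := by
          rw [integral_const_mul]; ring
      _ ≤ (1 / 2) ^ 2 * ((k + 1) ^ 2 * (((1 / 2) ^ k * k.factorial) ^ 2 * ∫ x, w x ^ 2)) := by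
          refine mul_le_mul he (mul_le_mul_of_nonneg_left ih (sq_nonneg _)) ?_ (by positivity)
          exact mul_nonneg (sq_nonneg _) (integral_nonneg fun x => by positivity)
      _ = _ := by rw [Nat.factorial_succ]; push_cast; ring

/-- An eigenfunction vanishing near `q` vanishes at `q + e` for every sufficiently short `e`. -/
theorem eq_zero_of_eventuallyEq_zero_of_translate {η w : 𝔼 → ℝ} (hη : ContDiff ℝ ∞ η)
    (hη1 : ∀ x, |η x| ≤ 1) {K : ℝ} (hK : ∀ x, ∑ i, partialDeriv i η x ^ 2 ≤ K)
    (hw : ContDiff ℝ ∞ w) (hws : HasCompactSupport w) {κ : ℝ} (hκ : 0 ≤ κ)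
    (h : ∀ x, η x ≠ 0 → euclideanLaplacian w x = -κ * w x) {e : 𝔼}
    (he : ‖e‖ ^ 2 * (2 * κ + 4 * K) ≤ (1 / 2) ^ 2) {q : 𝔼} {ε : ℝ} (hε : 0 < ε)
    (hηq : ∀ y ∈ Metric.ball q ε, ∀ t ∈ Set.Icc (0 : ℝ) 1, η (y + t • e) = 1)
    (hq : ∀ y ∈ Metric.ball q ε, w y = 0) : w (q + e) = 0 := by
  let ψ : ContDiffBump q := ⟨ε / 2, ε, by positivity, by linarith⟩
  let φ : 𝔼 → ℝ := fun y => ψ y * w (y + e)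
  have hwe : Continuous fun y => w (y + e) := hw.continuous.comp (by fun_prop)
  have hφ : Continuous φ := ψ.continuous.mul hwe
  have hφs : HasCompactSupport φ := ψ.hasCompactSupport.mul_right
  have hφ0 : ∀ y, y ∉ Metric.ball q ε → φ y = 0 := fun y hy => by
    have : ψ y = 0 := by rw [← Function.notMem_support, ψ.support_eq]; exact hy
    simp [φ, this]
  let J : ℕ → ℝ → ℝ := fun k t => ∫ y, φ y * (dirDeriv e)^[k] w (y + t • e)
  have hwk : ∀ k, ContDiff ℝ ∞ ((dirDeriv e)^[k] w) := hw.iterate_dirDeriv e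
  have hwks : ∀ k, HasCompactSupport ((dirDeriv e)^[k] w) := hws.iterate_dirDeriv e
  have hJ : ∀ k t, HasDerivAt (J k) (J (k + 1) t) t := fun k t => by
    simp only [J, Function.iterate_succ_apply']
    exact hasDerivAt_integral_mul_comp_add_smul volume hφ hφs (hwk k) (hwks k) e t
  have hJ0 : ∀ k, J k 0 = 0 := fun k => by
    refine integral_eq_zero_of_ae (Eventually.of_forall fun y => ?_)
    by_cases hy : y ∈ Metric.ball q ε
    · have : w =ᶠ[𝓝 y] 0 := (Metric.isOpen_ball.mem_nhds hy |> Filter.mem_of_superset) hq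
      simp [(eventuallyEq_zero_iterate_dirDeriv this e k).eq_of_nhds]
    · simp [hφ0 y hy]
  have hφi : Integrable fun y => φ y ^ 2 := by
    refine Continuous.integrable_of_hasCompactSupport (by fun_prop) ?_
    simp only [sq]
    exact hφs.mul_right
  have hb : ∀ k, ∀ t ∈ Set.Icc (0 : ℝ) 1, |J k t| ≤
      ((∫ y, φ y ^ 2) + ∫ y, w y ^ 2) / 2 * ((1 / 2) ^ k * k.factorial) := by
    intro k t ht
    set b : ℝ := (1 / 2) ^ k * k.factorial with hb_def
    have hb0 : 0 < b := by positivity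
    let G : 𝔼 → ℝ := fun y => (η y ^ k) ^ 2 * (dirDeriv e)^[k] w y ^ 2
    have hGc : Continuous G :=
      ((hη.continuous.pow _).pow _).mul ((hwk k).continuous.pow _)
    have hGi : Integrable G := by
      refine hGc.integrable_of_hasCompactSupport ?_
      simp only [G, sq ((dirDeriv e)^[k] w _)]
      exact ((hwks k).mul_right).mul_left
    have hGi' : Integrable fun y => G (y + t • e) := hGi.comp_add_right _
    have hpt : ∀ y, |φ y * (dirDeriv e)^[k] w (y + t • e)| ≤
        b / 2 * φ y ^ 2 + (2 * b)⁻¹ * G (y + t • e) := by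
      intro y
      by_cases hy : y ∈ Metric.ball q ε
      · simp only [G, hηq y hy t ht, one_pow, one_mul]
        set a := (dirDeriv e)^[k] w (y + t • e)
        rw [abs_mul, ← sq_abs (φ y), ← sq_abs a]
        have : b / 2 * |φ y| ^ 2 + (2 * b)⁻¹ * |a| ^ 2 - |φ y| * |a| =
            (2 * b)⁻¹ * (b * |φ y| - |a|) ^ 2 := by field_simp; ring
        have h2 : 0 ≤ (2 * b)⁻¹ * (b * |φ y| - |a|) ^ 2 := by positivity
        linarith
      · rw [hφ0 y hy]
        simp only [zero_mul, abs_zero, G]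
        positivity
    calc |J k t| ≤ ∫ y, |φ y * (dirDeriv e)^[k] w (y + t • e)| := abs_integral_le_integral_abs
      _ ≤ ∫ y, (b / 2 * φ y ^ 2 + (2 * b)⁻¹ * G (y + t • e)) := by
          refine integral_mono_of_nonneg (Eventually.of_forall fun y => abs_nonneg _)
            ((hφi.const_mul _).add (hGi'.const_mul _)) (Eventually.of_forall hpt)
      _ = b / 2 * (∫ y, φ y ^ 2) + (2 * b)⁻¹ * ∫ y, G y := by
          rw [integral_add (hφi.const_mul _) (hGi'.const_mul _), integral_const_mul,
            integral_const_mul, integral_add_right_eq_self G]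
      _ ≤ b / 2 * (∫ y, φ y ^ 2) + (2 * b)⁻¹ * (b ^ 2 * ∫ y, w y ^ 2) := by
          gcongr
          exact integral_iterate_dirDeriv_sq_le hη hη1 hK hw hws hκ h he k
      _ = _ := by field_simp
  have hJ1 : J 0 1 = 0 :=
    eq_zero_of_hasDerivAt_succ_of_le_factorial hJ hJ0 (by norm_num) (by norm_num) hb
  by_contra hne
  have hpos : 0 < ∫ y, ψ y * w (y + e) ^ 2 := by
    refine Continuous.integral_pos_of_hasCompactSupport_nonneg_nonzero (x := q)
      (ψ.continuous.mul (hwe.pow 2)) ψ.hasCompactSupport.mul_right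
      (fun y => mul_nonneg ψ.nonneg (sq_nonneg _)) ?_
    rw [ψ.one_of_mem_closedBall (Metric.mem_closedBall_self ψ.rIn_pos.le)]
    simpa using hne
  refine hpos.ne' (Eq.trans ?_ hJ1)
  refine integral_congr_ae (Eventually.of_forall fun y => ?_)
  simp only [φ, Function.iterate_zero, id, one_smul]
  ring

theorem exists_ball_forall_eq_zero {w : 𝔼 → ℝ} (hw : ContDiff ℝ ∞ w)
    (hws : HasCompactSupport w) {κ : ℝ} (hκ : 0 ≤ κ) {p : 𝔼} {R : ℝ} (hR : 0 < R)
    (h : ∀ x ∈ Metric.ball p R, euclideanLaplacian w x = -κ * w x) :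
    ∃ ρ > 0, ∀ q ∈ Metric.ball p ρ, w =ᶠ[𝓝 q] 0 → ∀ x ∈ Metric.ball p ρ, w x = 0 := by
  let η : ContDiffBump p := ⟨R / 2, R, by positivity, by linarith⟩
  have hη : ContDiff ℝ ∞ η := η.contDiff
  have hη1 : ∀ x, |η x| ≤ 1 := fun x => by rw [abs_of_nonneg η.nonneg]; exact η.le_one
  have hη0 : ∀ x, η x ≠ 0 → euclideanLaplacian w x = -κ * w x := fun x hx =>
    h x (by rw [← Function.mem_support, η.support_eq] at hx; exact hx)
  obtain ⟨K, hK⟩ : ∃ K, ∀ x, ∑ i, partialDeriv i η x ^ 2 ≤ K := by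
    choose C hC using fun i : Fin n =>
      (η.hasCompactSupport.dirDeriv (EuclideanSpace.single i 1)).exists_bound_of_continuous
        (hη.dirDeriv _).continuous
    refine ⟨∑ i, C i ^ 2, fun x => Finset.sum_le_sum fun i _ => ?_⟩
    rw [← sq_abs]
    exact pow_le_pow_left₀ (abs_nonneg _) (hC i x) 2
  have hK0 : 0 ≤ K := (Finset.sum_nonneg fun i _ => sq_nonneg _).trans (hK p)
  set A := 2 * κ + 4 * K + 1 with hA
  have hA1 : 1 ≤ A := by linarith
  refine ⟨min (R / 8) (1 / (4 * A)), by positivity, fun q hq hwq x hx => ?_⟩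
  set ρ := min (R / 8) (1 / (4 * A)) with hρ
  have hρ1 : ρ ≤ R / 8 := min_le_left _ _
  have hρ2 : ρ * A ≤ 1 / 4 := by
    have := min_le_right (R / 8) (1 / (4 * A))
    rw [← hρ, le_div_iff₀ (by positivity)] at this
    linarith
  have hρ0 : 0 < ρ := by positivity
  obtain ⟨δ, hδ, hδq⟩ := Metric.eventually_nhds_iff_ball.1 hwq
  rw [Metric.mem_ball, dist_eq_norm] at hq hx
  have hen : ‖x - q‖ ≤ 2 * ρ := by
    rw [show x - q = (x - p) - (q - p) by abel]
    exact (norm_sub_le _ _).trans (by linarith)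
  rw [show x = q + (x - q) by abel]
  refine eq_zero_of_eventuallyEq_zero_of_translate hη hη1 hK hw hws hκ hη0 ?_
    (lt_min hδ hρ0) ?_ (fun y hy => hδq y (Metric.ball_subset_ball (min_le_left _ _) hy))
  · calc ‖x - q‖ ^ 2 * (2 * κ + 4 * K) ≤ (2 * ρ) ^ 2 * A ^ 2 := by
          gcongr
          nlinarith
      _ = (2 * (ρ * A)) ^ 2 := by ring
      _ ≤ (1 / 2) ^ 2 := by gcongr; linarith
  · intro y hy t ht
    refine η.one_of_mem_closedBall ?_
    have hy' : ‖y - q‖ < ρ := by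
      rw [← dist_eq_norm]; exact (Metric.mem_ball.1 hy).trans_le (min_le_right _ _)
    have ht' : ‖t • (x - q)‖ ≤ 2 * ρ := by
      rw [norm_smul, Real.norm_of_nonneg ht.1]
      exact (mul_le_of_le_one_left (norm_nonneg _) ht.2).trans hen
    rw [Metric.mem_closedBall, dist_eq_norm,
      show y + t • (x - q) - p = (y - q) + (q - p) + t • (x - q) by abel]
    refine (norm_add₃_le).trans ?_
    change _ ≤ R / 2
    linarith

/-- Unique continuation for eigenfunctions of the Laplacian: an eigenfunction on a connected
open set which vanishes near one point vanishes identically. -/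
theorem eqOn_zero_of_euclideanLaplacian_eq {U : Set 𝔼} (hU : IsOpen U)
    (hUc : IsPreconnected U) {κ : ℝ} (hκ : 0 ≤ κ) {u : 𝔼 → ℝ} (hu : ContDiffOn ℝ ∞ u U)
    (h : ∀ x ∈ U, euclideanLaplacian u x = -κ * u x) {x₀ : 𝔼} (hx₀ : x₀ ∈ U)
    (hux₀ : u =ᶠ[𝓝 x₀] 0) : ∀ x ∈ U, u x = 0 := by
  suffices hs : U ⊆ {x | u =ᶠ[𝓝 x] 0} from fun x hx => (hs hx).eq_of_nhds
  refine hUc.subset_of_closure_inter_subset isOpen_setOfPred_eventually_nhds ⟨x₀, hx₀, hux₀⟩ ?_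
  rintro p ⟨hpc, hpU⟩
  obtain ⟨r, hr, hrU⟩ := Metric.isOpen_iff.1 hU p hpU
  let χ : ContDiffBump p := ⟨r / 4, r / 2, by positivity, by linarith⟩
  let w : 𝔼 → ℝ := fun x => χ x * u x
  have hw : ContDiff ℝ ∞ w := by
    refine contDiff_iff_contDiffAt.2 fun x => ?_
    by_cases hx : x ∈ U
    · exact χ.contDiffAt.mul (hu.contDiffAt (hU.mem_nhds hx))
    · have hxs : x ∉ tsupport χ := fun hx' => hx <| hrU <| by
        rw [χ.tsupport_eq] at hx'
        exact Metric.closedBall_subset_ball (by change r / 2 < r; linarith) hx'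
      refine (contDiffAt_const (c := (0 : ℝ))).congr_of_eventuallyEq ?_
      filter_upwards [notMem_tsupport_iff_eventuallyEq.1 hxs] with y hy
      simp [w, hy]
  have hwu : ∀ x ∈ Metric.ball p (r / 4), w =ᶠ[𝓝 x] u := fun x hx => by
    filter_upwards [Metric.isOpen_ball.mem_nhds hx] with y hy
    simp [w, χ.one_of_mem_closedBall (Metric.ball_subset_closedBall hy)]
  obtain ⟨ρ, hρ, hρw⟩ := exists_ball_forall_eq_zero hw χ.hasCompactSupport.mul_right hκ
    (R := r / 4) (p := p) (by positivity) fun x hx => by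
      rw [(hwu x hx).euclideanLaplacian_eq, (hwu x hx).eq_of_nhds]
      exact h x (hrU (Metric.ball_subset_ball (by linarith) hx))
  obtain ⟨q, hq, hpq⟩ := Metric.mem_closure_iff.1 hpc (min ρ (r / 4)) (by positivity)
  rw [dist_comm, lt_min_iff] at hpq
  have hzero := hρw q hpq.1 ((hwu q hpq.2).trans hq)
  have hwp : w =ᶠ[𝓝 p] 0 :=
    Filter.mem_of_superset (Metric.ball_mem_nhds p hρ) hzero
  exact (hwu p (Metric.mem_ball_self (by positivity))).symm.trans hwp

end Laplacian

/-- Two Laplace eigenfunctions (for the same eigenvalue) on a nonempty open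
connected set whose squares agree everywhere agree up to a single global sign. -/
theorem eigenfunction_sq_determines_up_to_sign (n : ℕ) (hn : 1 ≤ n)
    (U : Set (EuclideanSpace ℝ (Fin n))) (hUopen : IsOpen U) (hUconn : IsConnected U)
    (lam : ℝ) (f g : EuclideanSpace ℝ (Fin n) → ℝ)
    (hf : ContDiffOn ℝ (⊤ : ℕ∞) f U) (hg : ContDiffOn ℝ (⊤ : ℕ∞) g U)
    (heigf : ∀ x ∈ U, euclideanLaplacian f x = -lam ^ 2 * f x)
    (heigg : ∀ x ∈ U, euclideanLaplacian g x = -lam ^ 2 * g x)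
    (hsq : ∀ x ∈ U, (f x) ^ 2 = (g x) ^ 2) :
    (∀ x ∈ U, f x = g x) ∨ (∀ x ∈ U, f x = -g x) := by
  by_cases hsum : ∀ x ∈ U, f x = -g x
  · exact Or.inr hsum
  push Not at hsum
  obtain ⟨x₀, hx₀, hne⟩ := hsum
  left
  have hf2 : ∀ x ∈ U, ContDiffAt ℝ 2 f x := fun x hx =>
    (hf.contDiffAt (hUopen.mem_nhds hx)).of_le (by norm_cast)
  have hg2 : ∀ x ∈ U, ContDiffAt ℝ 2 g x := fun x hx =>
    (hg.contDiffAt (hUopen.mem_nhds hx)).of_le (by norm_cast)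
  have hev : f - g =ᶠ[𝓝 x₀] 0 := by
    have hcont : ContinuousAt (fun x => f x + g x) x₀ :=
      (hf2 x₀ hx₀).continuousAt.add (hg2 x₀ hx₀).continuousAt
    filter_upwards [hUopen.mem_nhds hx₀,
      hcont.eventually_ne (fun h0 => hne (eq_neg_of_add_eq_zero_left h0))] with x hx hx'
    have : (f x + g x) * (f x - g x) = 0 := by linear_combination hsq x hx
    exact (mul_eq_zero.1 this).resolve_left hx'
  have hzero := eqOn_zero_of_euclideanLaplacian_eq hUopen hUconn.isPreconnected
    (sq_nonneg lam) (hf.sub hg) (fun x hx => by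
      change euclideanLaplacian (f - g) x = _
      rw [euclideanLaplacian_sub (hf2 x hx) (hg2 x hx), heigf x hx, heigg x hx]
      ring) hx₀ hev
  exact fun x hx => sub_eq_zero.1 (hzero x hx)
end

section
/- Let n ≥ 1, let x₀ ∈ ℝⁿ and v ∈ ℝⁿ, and let φ : ℝⁿ → ℝ be a smooth function with φ(x₀) = 1. For λ > 0 define f_λ : ℝⁿ → ℝ by f_λ(x) = e^{λ ⟨v, x − x₀⟩} φ(x), where ⟨·,·⟩ is the Euclidean inner product. Then λ^{−2} · (Δ f_λ)(x₀) → ‖v‖² as λ → ∞, where Δ is the Euclidean Laplacian. -/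
open scoped BigOperators RealInnerProductSpace

section ExponentialFactor

variable {E : Type*} [NormedAddCommGroup E] [InnerProductSpace ℝ E]

theorem hasFDerivAt_exp_mul_inner_sub (v x₀ : E) (c : ℝ) (x : E) :
    HasFDerivAt (fun y => Real.exp (c * ⟪v, y - x₀⟫))
      (Real.exp (c * ⟪v, x - x₀⟫) • c • innerSL ℝ v) x := by
  have h : HasFDerivAt (fun y => ⟪v, y - x₀⟫) (innerSL ℝ v) x :=
    (innerSL ℝ v).hasFDerivAt.comp x ((hasFDerivAt_id x).sub_const x₀)
  exact (h.const_mul c).exp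

theorem fderiv_exp_mul_inner_sub_mul {φ : E → ℝ} (v x₀ : E) (c : ℝ) {x : E}
    (hφ : DifferentiableAt ℝ φ x) :
    fderiv ℝ (fun y => Real.exp (c * ⟪v, y - x₀⟫) * φ y) x =
      Real.exp (c * ⟪v, x - x₀⟫) • (fderiv ℝ φ x + φ x • c • innerSL ℝ v) := by
  rw [((hasFDerivAt_exp_mul_inner_sub v x₀ c x).fun_mul hφ.hasFDerivAt).fderiv,
    smul_add, smul_comm (φ x)]

theorem iteratedFDeriv_two_exp_mul_inner_sub_mul {φ : E → ℝ} (hφ : ContDiff ℝ 2 φ)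
    (v x₀ : E) (c : ℝ) (w : E) :
    iteratedFDeriv ℝ 2 (fun y => Real.exp (c * ⟪v, y - x₀⟫) * φ y) x₀ ![w, w] =
      iteratedFDeriv ℝ 2 φ x₀ ![w, w] + 2 * c * (⟪v, w⟫ * fderiv ℝ φ x₀ w) +
        c ^ 2 * (φ x₀ * ⟪v, w⟫ ^ 2) := by
  have hd : Differentiable ℝ φ := hφ.differentiable (by norm_num)
  have hd' : Differentiable ℝ (fderiv ℝ φ) :=
    (hφ.fderiv_right (m := 1) (by norm_num)).differentiable (by norm_num)
  have hD : fderiv ℝ (fun y => Real.exp (c * ⟪v, y - x₀⟫) * φ y) =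
      fun x => Real.exp (c * ⟪v, x - x₀⟫) • (fderiv ℝ φ x + φ x • c • innerSL ℝ v) :=
    funext fun x => fderiv_exp_mul_inner_sub_mul v x₀ c (hd x)
  have hD' := (hasFDerivAt_exp_mul_inner_sub v x₀ c x₀).fun_smul
    ((hd' x₀).hasFDerivAt.fun_add ((hd x₀).hasFDerivAt.smul_const (c • innerSL ℝ v)))
  rw [iteratedFDeriv_two_apply, iteratedFDeriv_two_apply, hD, hD'.fderiv]
  simp
  ring

end ExponentialFactor

theorem euclideanLaplacian_exp_mul_inner_sub_mul {n : ℕ} {φ : EuclideanSpace ℝ (Fin n) → ℝ}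
    (hφ : ContDiff ℝ 2 φ) (v x₀ : EuclideanSpace ℝ (Fin n)) (c : ℝ) :
    euclideanLaplacian (fun y => Real.exp (c * ⟪v, y - x₀⟫) * φ y) x₀ =
      euclideanLaplacian φ x₀ + 2 * c * fderiv ℝ φ x₀ v + c ^ 2 * (φ x₀ * ‖v‖ ^ 2) := by
  have hv : ∑ i, v i • EuclideanSpace.single i (1 : ℝ) = v := by
    simpa using (EuclideanSpace.basisFun (Fin n) ℝ).sum_repr v
  have hfd : fderiv ℝ φ x₀ v = ∑ i, v i * fderiv ℝ φ x₀ (EuclideanSpace.single i 1) := by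
    conv_lhs => rw [← hv]
    simp only [map_sum, map_smul, smul_eq_mul]
  simp only [euclideanLaplacian, iteratedFDeriv_two_exp_mul_inner_sub_mul hφ,
    Finset.sum_add_distrib, ← Finset.mul_sum, EuclideanSpace.real_norm_sq_eq, hfd,
    EuclideanSpace.inner_single_right, one_mul, conj_trivial]

/-- The rescaled Laplacian of the oscillating test function
`f_λ(x) = e^{λ ⟨v, x - x₀⟩} φ(x)` at `x₀` recovers `‖v‖²` as `λ → ∞`. -/
theorem rescaled_laplacian_recovers_norm_sq (n : ℕ) (hn : 1 ≤ n)
    (x₀ v : EuclideanSpace ℝ (Fin n)) (φ : EuclideanSpace ℝ (Fin n) → ℝ)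
    (hφ : ContDiff ℝ (⊤ : ℕ∞) φ) (hφx₀ : φ x₀ = 1) :
    Filter.Tendsto
      (fun lam : ℝ =>
        (lam ^ 2)⁻¹ *
          euclideanLaplacian (fun x => Real.exp (lam * ⟪v, x - x₀⟫) * φ x) x₀)
      Filter.atTop (nhds (‖v‖ ^ 2)) := by
  have hφ₂ : ContDiff ℝ 2 φ := contDiff_infty.mp hφ 2
  simp only [euclideanLaplacian_exp_mul_inner_sub_mul hφ₂, hφx₀, one_mul]
  have hinv : Filter.Tendsto (fun c : ℝ => c⁻¹) Filter.atTop (nhds 0) := tendsto_inv_atTop_zero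
  have hlim : Filter.Tendsto
      (fun c : ℝ => c⁻¹ ^ 2 * euclideanLaplacian φ x₀ + c⁻¹ * (2 * fderiv ℝ φ x₀ v) + ‖v‖ ^ 2)
      Filter.atTop (nhds (‖v‖ ^ 2)) := by
    simpa using (((hinv.pow 2).mul_const (euclideanLaplacian φ x₀)).add
      (hinv.mul_const (2 * fderiv ℝ φ x₀ v))).add_const (‖v‖ ^ 2)
  refine hlim.congr' ?_
  filter_upwards [Filter.eventually_ne_atTop (0 : ℝ)] with c hc
  field_simp
end
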